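/- arXiv:2503.06334 — 6 statements merged into one kernel-verified Lean document; each statement's English description precedes it below -/
import Mathlib

section
/- Let a, b, c, d, σ, τ ∈ ℂ with a*d - b*c = 1 and c*τ + d ≠ 0, and set t = (a*τ + b)/(c*τ + d). Then !![d, -b; -c, a] * (1 + σ • A(t)) * !![a, b; c, d] = 1 + (σ/(c*τ + d)^2) • A(τ), where A(t) = !![t, -t^2; 1, -t]. -/
open Matrix

/-- Discrete chain rule for the Schwarzian derivative under pre-composition by
the Möbius transformation `m(z) = (az+b)/(cz+d)` with `ad - bc = 1`:
conjugating `1 + σ • A(t)` by the matrix of `m`, where `t = m(τ)`, yields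
`1 + (σ/(cτ+d)^2) • A(τ)`. -/
theorem discrete_chain_rule (a b c d σ τ : ℂ) (hdet : a * d - b * c = 1)
    (hden : c * τ + d ≠ 0) (t : ℂ) (ht : t = (a * τ + b) / (c * τ + d)) :
    !![d, -b; -c, a] * (1 + σ • (!![t, -t^2; 1, -t] : Matrix (Fin 2) (Fin 2) ℂ)) *
        !![a, b; c, d] =
      1 + (σ / (c * τ + d) ^ 2) • (!![τ, -τ^2; 1, -τ] : Matrix (Fin 2) (Fin 2) ℂ) := by
  obtain ⟨u, hu⟩ : ∃ u : ℂ, u = (c * τ + d)⁻¹ := ⟨_, rfl⟩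
  have hu1 : (c * τ + d) * u = 1 := by rw [hu]; exact mul_inv_cancel₀ hden
  have ht' : t = (a * τ + b) * u := by rw [ht, hu, div_eq_mul_inv]
  have hs : σ / (c * τ + d) ^ 2 = σ * u ^ 2 := by rw [hu, div_eq_mul_inv, inv_pow]
  have h1 : d * t - b = τ * u := by
    rw [ht']; linear_combination τ * u * hdet + b * hu1
  have h2 : a - c * t = u := by
    rw [ht']; linear_combination u * hdet - a * hu1
  rw [hs, Matrix.one_fin_two]
  ext i j
  fin_cases i <;> fin_cases j <;> simp [Matrix.mul_apply, Fin.sum_univ_two]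
  · linear_combination hdet + σ * (a - c * t) * h1 + σ * τ * u * h2
  · linear_combination -σ * (d * t - b) * h1 - σ * τ * u * h1
  · linear_combination σ * (a - c * t) * h2 + σ * u * h2
  · linear_combination hdet - σ * (d * t - b) * h2 - σ * u * h1
end

section
/- Let a, b, c, d, s, σ ∈ ℂ with a*d - b*c = 1 and c + d ≠ 0; set t = (a + b)/(c + d) and s' = s + σ/(c + d)^2. Then !![1 + s, -s; s, 1 - s] * !![d, -b; -c, a] * (1 + σ • A(t)) * !![a, b; c, d] = !![1 + s', -s'; s', 1 - s'], where A(t) = !![t, -t^2; 1, -t]. -/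
open Matrix

/-- Relation between the intrinsic schwarzians `s, s'` of domain and image
patches and the discrete Schwarzian derivative `σ`:
`M_s * m⁻¹ * (1 + σ • A(t)) * m = M_{s'}`, where `t = m(1)` and
`s' = s + σ/(c+d)^2`. -/
theorem intrinsic_schwarzian_relation (a b c d s σ : ℂ) (hdet : a * d - b * c = 1)
    (hden : c + d ≠ 0) (t s' : ℂ) (ht : t = (a + b) / (c + d))
    (hs' : s' = s + σ / (c + d) ^ 2) :
    !![1 + s, -s; s, 1 - s] * !![d, -b; -c, a] *
        (1 + σ • (!![t, -t^2; 1, -t] : Matrix (Fin 2) (Fin 2) ℂ)) * !![a, b; c, d] =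
      !![1 + s', -s'; s', 1 - s'] := by
  obtain ⟨u, hu⟩ : ∃ u : ℂ, u = 1 / (c + d) := ⟨_, rfl⟩
  have h1 : d * t - b = u := by
    rw [ht, hu]; field_simp; linear_combination hdet
  have h2 : a - t * c = u := by
    rw [ht, hu]; field_simp; linear_combination hdet
  have h3 : s' = s + σ * u ^ 2 := by
    rw [hs', hu]; field_simp
  have key : !![d, -b; -c, a] *
        (1 + σ • (!![t, -t^2; 1, -t] : Matrix (Fin 2) (Fin 2) ℂ)) * !![a, b; c, d] =
      !![1 + σ * u ^ 2, -(σ * u ^ 2); σ * u ^ 2, 1 - σ * u ^ 2] := by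
    rw [Matrix.one_fin_two]
    ext i j
    fin_cases i <;> fin_cases j <;> simp [Matrix.mul_apply, Fin.sum_univ_two]
    · linear_combination hdet + σ * ((a - t * c) * h1 + u * h2)
    · linear_combination -σ * ((d * t - b) * h1 + u * h1)
    · linear_combination σ * ((a - t * c) * h2 + u * h2)
    · linear_combination hdet - σ * ((a - t * c) * h1 + u * h2)
  rw [Matrix.mul_assoc, Matrix.mul_assoc, ← Matrix.mul_assoc !![d, -b; -c, a], key, h3]
  ext i j
  fin_cases i <;> fin_cases j <;> simp [Matrix.mul_apply, Fin.sum_univ_two] <;> ring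
end

section
/- Let u > 0 be real and consider the closed balls in ℂ: B₁ = closedBall(-i, 1), B₂ = closedBall(2/(√3·u) - i/(3u²), 1/(3u²)), and B₃ = closedBall(4/(√3·u) - i, 1). Then the interiors of B₁, B₂, B₃ are pairwise disjoint and B₂ is contained in the half-plane {z : Im z ≥ -2} if and only if 1/√3 ≤ u ≤ 2/√3. -/
open Complex Metric

theorem dist_aux (a b c d R : ℝ) (hR : 0 ≤ R) (x y : ℂ) (hx : x = ⟨a, b⟩) (hy : y = ⟨c, d⟩) :
    R ≤ dist x y ↔ R ^ 2 ≤ (a - c) ^ 2 + (b - d) ^ 2 := by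
  subst hx hy
  rw [Complex.dist_eq_re_im]
  exact Real.le_sqrt hR (by positivity)

/-- Univalence criterion for 4-flowers: the three petals `c₁, c₂, c₃` of the
normalized 4-flower have pairwise disjoint interiors and `c₂` stays in the
half-plane `Im z ≥ -2` if and only if `1/√3 ≤ u ≤ 2/√3`. -/
theorem four_flower_univalence (u : ℝ) (hu : 0 < u) :
    (((Disjoint (interior (closedBall (-Complex.I) 1))
        (interior (closedBall (((2 / (Real.sqrt 3 * u) : ℝ) : ℂ) -
          ((1 / (3 * u ^ 2) : ℝ) : ℂ) * Complex.I) (1 / (3 * u ^ 2)))) ∧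
      Disjoint (interior (closedBall (-Complex.I) 1))
        (interior (closedBall (((4 / (Real.sqrt 3 * u) : ℝ) : ℂ) - Complex.I) 1)) ∧
      Disjoint (interior (closedBall (((2 / (Real.sqrt 3 * u) : ℝ) : ℂ) -
          ((1 / (3 * u ^ 2) : ℝ) : ℂ) * Complex.I) (1 / (3 * u ^ 2))))
        (interior (closedBall (((4 / (Real.sqrt 3 * u) : ℝ) : ℂ) - Complex.I) 1))) ∧
      (closedBall (((2 / (Real.sqrt 3 * u) : ℝ) : ℂ) -
          ((1 / (3 * u ^ 2) : ℝ) : ℂ) * Complex.I) (1 / (3 * u ^ 2)) ⊆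
        {z : ℂ | -2 ≤ z.im})) ↔
    (1 / Real.sqrt 3 ≤ u ∧ u ≤ 2 / Real.sqrt 3)) := by
  have hs : 0 < Real.sqrt 3 := by positivity
  have hs2 : Real.sqrt 3 ^ 2 = 3 := Real.sq_sqrt (by norm_num)
  have hr : 0 < 1 / (3 * u ^ 2) := by positivity
  have ha : 0 < 2 / (Real.sqrt 3 * u) := by positivity
  have h4 : 4 / (Real.sqrt 3 * u) = 2 * (2 / (Real.sqrt 3 * u)) := by ring
  have har : (2 / (Real.sqrt 3 * u)) ^ 2 = 4 * (1 / (3 * u ^ 2)) := by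
    rw [div_pow, mul_pow, hs2]; ring
  have e1 : 1 / Real.sqrt 3 ≤ u ↔ 1 / (3 * u ^ 2) ≤ 1 := by
    rw [div_le_iff₀ hs, div_le_one (by positivity)]
    have hp : 0 < u * Real.sqrt 3 := by positivity
    have hq : 3 * u ^ 2 = (u * Real.sqrt 3) ^ 2 := by rw [mul_pow, hs2]; ring
    rw [hq]
    exact (one_le_sq_iff₀ hp.le).symm
  have e2 : u ≤ 2 / Real.sqrt 3 ↔ 1 ≤ 2 / (Real.sqrt 3 * u) := by
    rw [le_div_iff₀ hs, le_div_iff₀ (by positivity), one_mul, mul_comm u]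
  rw [e1, e2, h4]
  generalize 2 / (Real.sqrt 3 * u) = a at *
  generalize 1 / (3 * u ^ 2) = r at *
  rw [interior_closedBall (_ : ℂ) (one_ne_zero : (1 : ℝ) ≠ 0), interior_closedBall (_ : ℂ) hr.ne',
    interior_closedBall (_ : ℂ) (one_ne_zero : (1 : ℝ) ≠ 0),
    disjoint_ball_ball_iff (one_pos : (0:ℝ) < 1) hr, disjoint_ball_ball_iff (one_pos : (0:ℝ) < 1) (one_pos : (0:ℝ) < 1),
    disjoint_ball_ball_iff hr (one_pos : (0:ℝ) < 1),
    dist_aux 0 (-1) a (-r) _ (by positivity) _ _ (by apply Complex.ext <;> simp)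
      (by apply Complex.ext <;> simp),
    dist_aux 0 (-1) (2 * a) (-1) _ (by positivity) _ _ (by apply Complex.ext <;> simp)
      (by apply Complex.ext <;> simp),
    dist_aux a (-r) (2 * a) (-1) _ (by positivity) _ _ (by apply Complex.ext <;> simp)
      (by apply Complex.ext <;> simp)]
  constructor
  · rintro ⟨⟨-, h, -⟩, hsub⟩
    constructor
    · have hm : (⟨a, -(2 * r)⟩ : ℂ) ∈ closedBall ((a : ℂ) - (r : ℂ) * Complex.I) r := by
        rw [mem_closedBall, Complex.dist_eq_re_im]
        apply Real.sqrt_le_iff.2 ⟨hr.le, ?_⟩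
        simp
        nlinarith
      have := hsub hm
      simp at this
      linarith
    · nlinarith
  · rintro ⟨h1, h2⟩
    refine ⟨⟨by nlinarith, by nlinarith, by nlinarith⟩, ?_⟩
    intro z hz
    rw [mem_closedBall, Complex.dist_eq] at hz
    have := (Complex.abs_im_le_norm _).trans hz
    simp at this
    have := (abs_le.1 this).1
    simp only [Set.mem_ofPred_eq]
    linarith
end

section
/- Let 0 < α < π/2 and define ξ = sin(2α) - i·cos(2α), ζ = -sin(2α) - i·cos(2α), and p = cos(α)·(sin(α) - i·cos(α))/(1 - sin(α)), all in ℂ. Suppose a, b, c, d ∈ ℂ satisfy a·d - b·c ≠ 0, c·(-i) + d = 0, a·ξ + b = 0, and a·p + b = -2i·(c·p + d). Then c·ζ + d ≠ 0 and (a·ζ + b)/(c·ζ + d) = 4·cos(α). -/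
open Complex

/-- Intrinsic schwarzian of a uniform flower: if `T(z) = (az+b)/(cz+d)` is the
Möbius transformation sending `(-i, p, ξ)` to `(∞, -2i, 0)`, then
`T(ζ) = 4 cos α`, i.e. `2√3(1-s) = 4 cos α`, giving `s = 1 - (2/√3) cos α`. -/
theorem uniform_flower_schwarzian (α : ℝ) (hα0 : 0 < α) (hα1 : α < Real.pi / 2)
    (ξ ζ p : ℂ)
    (hξ : ξ = (Real.sin (2 * α) : ℂ) - Complex.I * (Real.cos (2 * α) : ℂ))
    (hζ : ζ = -(Real.sin (2 * α) : ℂ) - Complex.I * (Real.cos (2 * α) : ℂ))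
    (hp : p = (Real.cos α : ℂ) * ((Real.sin α : ℂ) - Complex.I * (Real.cos α : ℂ)) /
        (1 - (Real.sin α : ℂ)))
    (a b c d : ℂ) (hdet : a * d - b * c ≠ 0)
    (h1 : c * (-Complex.I) + d = 0)
    (h2 : a * ξ + b = 0)
    (h3 : a * p + b = -2 * Complex.I * (c * p + d)) :
    c * ζ + d ≠ 0 ∧ (a * ζ + b) / (c * ζ + d) = 4 * (Real.cos α : ℂ) := by
  have hs : 0 < Real.sin α := Real.sin_pos_of_pos_of_lt_pi hα0 (by linarith [Real.pi_pos])
  have hk : 0 < Real.cos α := Real.cos_pos_of_mem_Ioo ⟨by linarith, hα1⟩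
  have hsq := Real.sin_sq_add_cos_sq α
  have hs1 : Real.sin α < 1 := by nlinarith
  rw [Real.sin_two_mul, Real.cos_two_mul] at hξ hζ
  generalize Real.sin α = s at *
  generalize Real.cos α = k at *
  have hsqC : (s : ℂ) ^ 2 + (k : ℂ) ^ 2 = 1 := by exact_mod_cast hsq
  have hsC : (s : ℂ) ≠ 0 := by exact_mod_cast hs.ne'
  have h1s : (1 - (s : ℂ)) ≠ 0 := by
    have : (1 - s) ≠ 0 := by linarith
    exact_mod_cast this
  have hw : (k : ℂ) - I * (1 - s) ≠ 0 := by
    intro h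
    have := congrArg Complex.re h
    simp at this
    linarith
  have hv : (k : ℂ) - I * s ≠ 0 := by
    intro h
    have := congrArg Complex.re h
    simp at this
    linarith
  have hI : I ^ 2 = -1 := Complex.I_sq
  push_cast at hξ hζ
  have hd : d = c * I := by linear_combination h1
  have hb : b = -a * ξ := by linear_combination h2
  have hc : c ≠ 0 := by
    rintro rfl
    apply hdet
    rw [hd]; ring
  have hp' : p * (1 - s) = k * (s - I * k) := by
    rw [hp]; field_simp
  have e1 : (p - ξ) * (1 - s) = -I * (k + I * s) * s * (k - I * (1 - s)) := by
    rw [hξ]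
    linear_combination hp' + I * (1 - s) * hsqC - (I * s ^ 2 * (1 - s) + s * k * (1 - s) - s ^ 2 * k) * hI
  have e2 : (p + I) * (1 - s) = s * (k - I * (1 - s)) := by
    linear_combination hp' - I * hsqC
  have h4 : a * (k + I * s) = 2 * c := by
    apply mul_right_cancel₀ (mul_ne_zero hsC hw)
    have h5 : a * ((p - ξ) * (1 - s)) = -2 * I * c * ((p + I) * (1 - s)) := by
      rw [hb, hd] at h3
      linear_combination (1 - (s : ℂ)) * h3
    rw [e1, e2] at h5
    apply mul_left_cancel₀ (neg_ne_zero.mpr I_ne_zero)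
    linear_combination h5
  have ha : a = 2 * c * (k - I * s) := by
    linear_combination (k - I * s) * h4 - a * hsqC + a * s ^ 2 * hI
  have hz : c * ζ + d = -2 * c * s * (k - I * s) := by
    rw [hd, hζ]
    linear_combination (-2 * c * I) * hsqC
  have hne : c * ζ + d ≠ 0 := by
    rw [hz]
    exact mul_ne_zero (mul_ne_zero (mul_ne_zero (by norm_num) hc) hsC) hv
  refine ⟨hne, ?_⟩
  rw [div_eq_iff hne, hz, hb, ha, hζ, hξ]
  ring
end

section
/- Let a, b > 0 be real and let (x₀, x₁, x₂, x₃, x₄, x₅) = (a, b, b/a, 1/a, 1/b, a/b). Then the sum over j = 0,…,5 (indices mod 6) of arccos((1 + xⱼ + x_{j+1} - xⱼ·x_{j+1})/((1 + xⱼ)·(1 + x_{j+1}))) equals 2π. -/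
open Real

lemma arccos_two_arctan (u : ℝ) (hu : 0 < u) (c : ℝ) (hc : c = (1 - u^2) / (1 + u^2)) :
    Real.arccos c = 2 * Real.arctan u := by
  have h1 : Real.cos (2 * Real.arctan u) = c := by
    rw [Real.cos_two_mul, Real.cos_sq_arctan, hc]
    field_simp
    ring
  rw [← h1, Real.arccos_cos]
  · have := Real.arctan_pos.2 hu
    linarith
  · have := Real.arctan_lt_pi_div_two u
    linarith

lemma arctan_three (x y z : ℝ) (hx : 0 < x) (hy : 0 < y) (hz : 0 < z)
    (h : x * y + y * z + x * z = 1) :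
    Real.arctan x + Real.arctan y + Real.arctan z = Real.pi / 2 := by
  have h1 : x * y < 1 := by nlinarith [mul_pos hy hz, mul_pos hx hz]
  have h2 : (x + y) / (1 - x * y) = z⁻¹ := by
    have : 1 - x * y = z * (x + y) := by linarith
    rw [this]
    have : x + y ≠ 0 := by positivity
    field_simp
  rw [Real.arctan_add h1, h2, Real.arctan_inv_of_pos hz]
  ring

noncomputable def faceAngle (x y : ℝ) : ℝ :=
  Real.arccos ((1 + x + y - x * y) / ((1 + x) * (1 + y)))

lemma faceAngle_comm (x y : ℝ) : faceAngle x y = faceAngle y x := by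
  unfold faceAngle
  congr 1
  ring

lemma faceAngle_sum (a b : ℝ) (ha : 0 < a) (hb : 0 < b) :
    faceAngle a b + faceAngle (b/a) (1/a) + faceAngle (1/b) (a/b) = Real.pi := by
  obtain ⟨p, hp, rfl⟩ : ∃ p : ℝ, 0 < p ∧ p^2 = a := ⟨√a, Real.sqrt_pos.2 ha, Real.sq_sqrt ha.le⟩
  obtain ⟨q, hq, rfl⟩ : ∃ q : ℝ, 0 < q ∧ q^2 = b := ⟨√b, Real.sqrt_pos.2 hb, Real.sq_sqrt hb.le⟩
  obtain ⟨r, hr, hr2⟩ : ∃ r : ℝ, 0 < r ∧ r^2 = 1 + p^2 + q^2 :=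
    ⟨√(1 + p^2 + q^2), Real.sqrt_pos.2 (by positivity), Real.sq_sqrt (by positivity)⟩
  unfold faceAngle
  rw [arccos_two_arctan (p * q / r) (by positivity),
    arccos_two_arctan (q / (p * r)) (by positivity),
    arccos_two_arctan (p / (q * r)) (by positivity)]
  · have := arctan_three (p * q / r) (q / (p * r)) (p / (q * r)) (by positivity) (by positivity)
      (by positivity) (by field_simp; linarith)
    linarith
  all_goals
    simp only [div_pow, mul_pow, hr2]
    field_simp
    ring

/-- Doyle flowers close up: for any `a, b > 0`, petals of radii
`a, b, b/a, 1/a, 1/b, a/b` around a central circle of radius 1 have face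
angles at the center summing to exactly `2π`. -/
theorem doyle_flower_closes (a b : ℝ) (ha : 0 < a) (hb : 0 < b) :
    ∑ j : Fin 6,
      Real.arccos ((1 + ![a, b, b/a, 1/a, 1/b, a/b] j + ![a, b, b/a, 1/a, 1/b, a/b] (j+1)
          - ![a, b, b/a, 1/a, 1/b, a/b] j * ![a, b, b/a, 1/a, 1/b, a/b] (j+1)) /
        ((1 + ![a, b, b/a, 1/a, 1/b, a/b] j) * (1 + ![a, b, b/a, 1/a, 1/b, a/b] (j+1)))) =
      2 * Real.pi := by
  have h1 := faceAngle_sum a b ha hb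
  have h2 := faceAngle_sum (1/a) (1/b) (by positivity) (by positivity)
  have e1 : (1/b)/(1/a) = a/b := by field_simp
  have e2 : (1/a)/(1/b) = b/a := by field_simp
  rw [e1, e2, one_div_one_div, one_div_one_div, faceAngle_comm (a/b) a] at h2
  have h3 : faceAngle a b + faceAngle b (b/a) + faceAngle (b/a) (1/a) + faceAngle (1/a) (1/b)
      + faceAngle (1/b) (a/b) + faceAngle (a/b) a = 2 * Real.pi := by
    rw [faceAngle_comm (a/b) a]
    linarith
  rw [← h3, Fin.sum_univ_six]
  rfl
end

section
/- Let r, R > 0 be real numbers and u ∈ ℝ with u ≠ 0 and √3·u ≠ √(R/r). Set w = 2R/(√3·u - √(R/r)), regarded as a complex number. Then ((√(R/r) + i)/2)·w + (R + √(r·R)·i) ≠ 0, and ((1 + √(r/R)·i)·w) / (((√(R/r) + i)/2)·w + (R + √(r·R)·i)) = 2/(√3·u). -/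
open Complex

/-- Layout formula (S3): with `w = 2R/(√3·u - √(R/r))` the displacement of the
target petal, the normalizing Möbius transformation of Situation 3 maps `w`
to `2/(√3·u)`. -/
theorem layout_formula_S3 (r R u : ℝ) (hr : 0 < r) (hR : 0 < R) (hu : u ≠ 0)
    (h : Real.sqrt 3 * u ≠ Real.sqrt (R / r)) :
    ((((Real.sqrt (R / r) : ℂ) + Complex.I) / 2) *
          ((2 * R / (Real.sqrt 3 * u - Real.sqrt (R / r)) : ℝ) : ℂ)
        + ((R : ℂ) + (Real.sqrt (r * R) : ℂ) * Complex.I) ≠ 0) ∧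
    ((1 + (Real.sqrt (r / R) : ℂ) * Complex.I) *
          ((2 * R / (Real.sqrt 3 * u - Real.sqrt (R / r)) : ℝ) : ℂ)) /
        ((((Real.sqrt (R / r) : ℂ) + Complex.I) / 2) *
            ((2 * R / (Real.sqrt 3 * u - Real.sqrt (R / r)) : ℝ) : ℂ)
          + ((R : ℂ) + (Real.sqrt (r * R) : ℂ) * Complex.I)) =
      2 / ((Real.sqrt 3 : ℂ) * (u : ℂ)) := by
  obtain ⟨a, ha, rfl⟩ : ∃ a : ℝ, 0 < a ∧ r = a ^ 2 :=
    ⟨Real.sqrt r, Real.sqrt_pos.2 hr, (Real.sq_sqrt hr.le).symm⟩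
  obtain ⟨b, hb, rfl⟩ : ∃ b : ℝ, 0 < b ∧ R = b ^ 2 :=
    ⟨Real.sqrt R, Real.sqrt_pos.2 hR, (Real.sq_sqrt hR.le).symm⟩
  have e1 : Real.sqrt (b ^ 2 / a ^ 2) = b / a := by
    rw [← div_pow, Real.sqrt_sq (by positivity)]
  have e2 : Real.sqrt (a ^ 2 / b ^ 2) = a / b := by
    rw [← div_pow, Real.sqrt_sq (by positivity)]
  have e3 : Real.sqrt (a ^ 2 * b ^ 2) = a * b := by
    rw [← mul_pow, Real.sqrt_sq (by positivity)]
  rw [e1] at h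
  rw [e1, e2, e3]
  have ht : Real.sqrt 3 * u ≠ 0 := mul_ne_zero (by positivity) hu
  rw [← Complex.ofReal_mul (Real.sqrt 3) u]
  generalize Real.sqrt 3 * u = t at *
  have hd : t - b / a ≠ 0 := sub_ne_zero.2 h
  obtain ⟨d, rfl⟩ : ∃ d, t = d + b / a := ⟨t - b / a, by ring⟩
  rw [add_sub_cancel_right] at *
  have ha' : (a : ℂ) ≠ 0 := by exact_mod_cast ha.ne'
  have hb' : (b : ℂ) ≠ 0 := by exact_mod_cast hb.ne'
  have hd' : (d : ℂ) ≠ 0 := by exact_mod_cast hd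
  have ht' : ((d + b / a : ℝ) : ℂ) ≠ 0 := by exact_mod_cast ht
  have hz : (b : ℂ) + a * Complex.I ≠ 0 := by
    intro h0
    have := congrArg Complex.re h0
    simp at this
    exact hb.ne' this
  have key : (((b / a : ℝ) : ℂ) + Complex.I) / 2 * ((2 * b ^ 2 / d : ℝ) : ℂ)
      + (((b ^ 2 : ℝ) : ℂ) + ((a * b : ℝ) : ℂ) * Complex.I)
      = b * ((d + b / a : ℝ) : ℂ) * (b + a * Complex.I) / d := by
    push_cast
    field_simp
    ring
  rw [key]
  have hne : b * ((d + b / a : ℝ) : ℂ) * (b + a * Complex.I) / d ≠ 0 :=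
    div_ne_zero (mul_ne_zero (mul_ne_zero hb' ht') hz) hd'
  refine ⟨hne, ?_⟩
  rw [div_eq_div_iff hne ht']
  generalize ((d + b / a : ℝ) : ℂ) = T
  push_cast
  field_simp
end
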